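/- arXiv:2211.02530 — 4 statements merged into one kernel-verified Lean document; each statement's English description precedes it below -/
import Mathlib

section
/- For every integer n ≥ 6 and every t ∈ ℝ, the physicists' Hermite polynomial satisfies |H_n(t)| < 30 · n^{2/3} · (2n/e)^{n/2} · exp(t²/2). -/
/-- Physicists' Hermite polynomials. -/
noncomputable def Hpoly : ℕ → ℝ → ℝ
  | 0 => fun _ => 1
  | 1 => fun t => 2 * t
  | n + 2 => fun t => 2 * t * Hpoly (n + 1) t - 2 * (n + 1) * Hpoly n t

open scoped Nat in
/-- An explicit upper Stirling bound. -/
theorem factorial_le_exp_mul_sqrt_mul_pow (n : ℕ) (hn : n ≠ 0) :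
    (n ! : ℝ) ≤ Real.exp 1 * √n * (n / Real.exp 1) ^ n := by
  obtain ⟨m, rfl⟩ := Nat.exists_eq_succ_of_ne_zero hn
  have h : Stirling.stirlingSeq (m + 1) ≤ Stirling.stirlingSeq 1 :=
    Stirling.stirlingSeq'_antitone (Nat.zero_le m)
  rw [Stirling.stirlingSeq_one, Stirling.stirlingSeq, div_le_iff₀ (by positivity),
    Real.sqrt_mul (by norm_num)] at h
  refine h.trans_eq ?_
  rw [Nat.succ_eq_add_one]
  field_simp

theorem hasDerivAt_exponent (t z : ℂ) :
    HasDerivAt (fun z : ℂ => 2 * t * z - z ^ 2) (2 * t - 2 * z) z := by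
  simpa using ((hasDerivAt_id' z).const_mul (2 * t)).fun_sub ((hasDerivAt_id' z).fun_pow 2)

/-- The iterated derivatives of the Hermite generating function satisfy the three-term
recurrence. -/
theorem iteratedDeriv_generating_add_two (t : ℂ) (n : ℕ) :
    iteratedDeriv (n + 2) (fun z : ℂ => Complex.exp (2 * t * z - z ^ 2)) = fun z =>
      2 * (t - z) * iteratedDeriv (n + 1) (fun z : ℂ => Complex.exp (2 * t * z - z ^ 2)) z
        - 2 * (n + 1) * iteratedDeriv n (fun z : ℂ => Complex.exp (2 * t * z - z ^ 2)) z := by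
  set f : ℂ → ℂ := fun z => Complex.exp (2 * t * z - z ^ 2)
  have hsmooth : ContDiff ℂ ⊤ f := by fun_prop
  have hd (k : ℕ) (z : ℂ) : HasDerivAt (iteratedDeriv k f) (iteratedDeriv (k + 1) f z) z := by
    rw [iteratedDeriv_succ]
    exact (hsmooth.differentiable_iteratedDeriv k (by simp) z).hasDerivAt
  have hlin (z : ℂ) : HasDerivAt (fun z : ℂ => 2 * (t - z)) (-2) z := by
    simpa using ((hasDerivAt_id z).const_sub t).const_mul 2
  have h1 : iteratedDeriv 1 f = fun z => 2 * (t - z) * f z := by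
    rw [iteratedDeriv_one]
    funext z
    rw [(hasDerivAt_exponent t z).cexp.deriv]
    ring
  induction n with
  | zero =>
    rw [iteratedDeriv_succ, h1]
    funext z
    have h := hd 0 z
    rw [zero_add, h1, iteratedDeriv_zero] at h
    rw [((hlin z).fun_mul h).deriv, iteratedDeriv_zero]
    push_cast
    ring
  | succ n ih =>
    rw [iteratedDeriv_succ]
    conv_lhs => rw [ih]
    funext z
    rw [(((hlin z).fun_mul (hd (n + 1) z)).fun_sub ((hd n z).const_mul (2 * ((n : ℂ) + 1)))).deriv]
    push_cast
    ring

theorem iteratedDeriv_generating_zero (t : ℝ) (n : ℕ) :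
    iteratedDeriv n (fun z : ℂ => Complex.exp (2 * t * z - z ^ 2)) 0 = Hpoly n t := by
  induction n using Nat.twoStepInduction with
  | zero => simp [Hpoly]
  | one =>
    rw [iteratedDeriv_one, (hasDerivAt_exponent t 0).cexp.deriv]
    simp [Hpoly]
  | more n ih₀ ih₁ =>
    rw [iteratedDeriv_generating_add_two]
    simp only [ih₀, ih₁, Hpoly]
    push_cast
    ring

open scoped Nat in
/-- Cauchy's estimate for the Hermite polynomials on the circle of radius `R`. -/
theorem abs_Hpoly_le (n : ℕ) (t : ℝ) {R : ℝ} (hR : 0 < R) :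
    |Hpoly n t| ≤ n ! * Real.exp (t ^ 2 / 2 + R ^ 2) / R ^ n := by
  have h := Complex.norm_iteratedDeriv_le_of_forall_mem_sphere_norm_le (c := 0)
    (f := fun z : ℂ => Complex.exp (2 * t * z - z ^ 2)) (C := Real.exp (t ^ 2 / 2 + R ^ 2)) n hR
    (Differentiable.diffContOnCl (by fun_prop)) (fun z hz => by
      rw [mem_sphere_zero_iff_norm] at hz
      have hz2 : z.re ^ 2 + z.im ^ 2 = R ^ 2 := by
        rw [← hz, Complex.sq_norm, Complex.normSq_apply]
        ring
      rw [Complex.norm_exp, Real.exp_le_exp]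
      simp only [Complex.sub_re, Complex.mul_re, Complex.mul_im, pow_two, Complex.ofReal_re,
        Complex.ofReal_im, Complex.re_ofNat, Complex.im_ofNat]
      nlinarith [sq_nonneg (t - 2 * z.re)])
  rwa [iteratedDeriv_generating_zero, Complex.norm_real, Real.norm_eq_abs] at h

/-- For every `n ≥ 6` and every `t ∈ ℝ`,
`|H_n(t)| < 30 n^(2/3) (2n/e)^(n/2) exp(t²/2)`. -/
theorem hermite_bound (n : ℕ) (hn : 6 ≤ n) (t : ℝ) :
    |Hpoly n t| < 30 * (n : ℝ) ^ ((2 : ℝ) / 3) *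
      (2 * n / Real.exp 1) ^ ((n : ℝ) / 2) * Real.exp (t ^ 2 / 2) := by
  have hn0 : (0 : ℝ) < n := by exact_mod_cast (by omega : 0 < n)
  have hn1 : (1 : ℝ) ≤ n := by exact_mod_cast (by omega : 1 ≤ n)
  have hsqrt : √(n : ℝ) ≤ (n : ℝ) ^ ((2 : ℝ) / 3) := by
    rw [Real.sqrt_eq_rpow]
    exact Real.rpow_le_rpow_of_exponent_le hn1 (by norm_num)
  have hbase : (n : ℝ) / Real.exp 1 * Real.exp (1 / 2) / √((n : ℝ) / 2)
      = √(2 * n / Real.exp 1) := by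
    symm
    rw [Real.sqrt_eq_iff_mul_self_eq (by positivity) (by positivity)]
    have h1 : √((n : ℝ) / 2) ^ 2 = n / 2 := Real.sq_sqrt (by positivity)
    have h2 : Real.exp (1 / 2) ^ 2 = Real.exp 1 := by
      rw [← Real.exp_nat_mul]
      norm_num
    rw [← pow_two, div_pow, mul_pow, div_pow, h1, h2]
    field_simp
  have hpow : (2 * n / Real.exp 1) ^ ((n : ℝ) / 2) = √(2 * n / Real.exp 1) ^ n := by
    rw [Real.sqrt_eq_rpow, ← Real.rpow_natCast, ← Real.rpow_mul (by positivity)]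
    congr 1
    ring
  have hexp : Real.exp ((n : ℝ) / 2) = Real.exp (1 / 2) ^ n := by
    rw [← Real.exp_nat_mul]
    congr 1
    ring
  rw [hpow]
  calc |Hpoly n t|
      ≤ n.factorial * Real.exp (t ^ 2 / 2 + √((n : ℝ) / 2) ^ 2) / √((n : ℝ) / 2) ^ n :=
        abs_Hpoly_le n t (by positivity)
    _ ≤ (Real.exp 1 * √n * (n / Real.exp 1) ^ n)
          * Real.exp (t ^ 2 / 2 + √((n : ℝ) / 2) ^ 2) / √((n : ℝ) / 2) ^ n := by
        gcongr
        exact factorial_le_exp_mul_sqrt_mul_pow n (by omega)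
    _ = Real.exp 1 * √n * √(2 * n / Real.exp 1) ^ n * Real.exp (t ^ 2 / 2) := by
        rw [Real.sq_sqrt (by positivity), Real.exp_add, hexp, ← hbase, div_pow _ (√((n : ℝ) / 2)), mul_pow]
        ring
    _ < 30 * (n : ℝ) ^ ((2 : ℝ) / 3) * √(2 * n / Real.exp 1) ^ n * Real.exp (t ^ 2 / 2) := by
        have he : Real.exp 1 < 30 := Real.exp_one_lt_d9.trans (by norm_num)
        gcongr ?_ * _ * _
        exact mul_lt_mul he hsqrt (by positivity) (by norm_num)
end

section
/- For every integer n ≥ 6 and every t ∈ ℝ, |φ_n(t)| < 30 · √n · exp(t²/2). -/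
open MeasureTheory Real

/-- Eigenvalues `λ_n = a^(n+1/2)` with `a = 2/(2+√5)`. -/
noncomputable def lam (n : ℕ) : ℝ := (2 / (2 + Real.sqrt 5)) ^ ((n : ℝ) + 1 / 2)

/-- Eigenfunctions `φ_n(t) = (b/√(2^n n!)) exp(-c t²) H_n(h t)` with
`b = 5^(1/8)`, `c = (√5-1)/2`, `h = 5^(1/4)`. -/
noncomputable def phi (n : ℕ) (t : ℝ) : ℝ :=
  ((5 : ℝ) ^ ((1 : ℝ) / 8) / Real.sqrt (2 ^ n * n.factorial)) *
    Real.exp (-((Real.sqrt 5 - 1) / 2) * t ^ 2) * Hpoly n ((5 : ℝ) ^ ((1 : ℝ) / 4) * t)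

open Filter Topology

section Oscillator

variable {u w : ℝ → ℝ} {c : ℝ}

/-- The energy `u'² + (c - x²) u²` of a solution of `u'' = (x² - c) u` does not increase on
`[0, ∞)`. -/
theorem oscillator_energy_le (hu : ∀ x, HasDerivAt u (w x) x)
    (hw : ∀ x, HasDerivAt w ((x ^ 2 - c) * u x) x) {x : ℝ} (hx : 0 ≤ x) :
    w x ^ 2 + (c - x ^ 2) * u x ^ 2 ≤ w 0 ^ 2 + c * u 0 ^ 2 := by
  have hE : ∀ y, HasDerivAt (fun y => w y ^ 2 + (c - y ^ 2) * u y ^ 2)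
      (-(2 * y * u y ^ 2)) y := by
    intro y
    have h := ((hw y).pow 2).add
      ((((hasDerivAt_id y).pow 2).const_sub c).mul ((hu y).pow 2))
    refine h.congr_deriv ?_
    simp only [id, Pi.pow_apply]
    push_cast
    ring
  have hanti : AntitoneOn (fun y => w y ^ 2 + (c - y ^ 2) * u y ^ 2) (Set.Ici 0) := by
    refine antitoneOn_of_hasDerivWithinAt_nonpos (convex_Ici 0)
      (fun y _ => (hE y).continuousAt.continuousWithinAt)
      (fun y _ => (hE y).hasDerivWithinAt) ?_
    intro y hy
    rw [interior_Ici] at hy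
    have hy0 : 0 < y := hy
    have : 0 ≤ 2 * y * u y ^ 2 := by positivity
    linarith
  simpa using hanti (Set.mem_Ici.2 le_rfl) (Set.mem_Ici.2 hx) hx

/-- Beyond the turning point `√c`, a solution of `u'' = (x² - c) u` with `u u' → 0` decreases in
absolute value. -/
theorem oscillator_sq_le_turning_point (hu : ∀ x, HasDerivAt u (w x) x)
    (hw : ∀ x, HasDerivAt w ((x ^ 2 - c) * u x) x)
    (hlim : Tendsto (fun x => u x * w x) atTop (𝓝 0)) {x : ℝ} (hx : √c ≤ x) :
    u x ^ 2 ≤ u √c ^ 2 := by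
  have hg : ∀ y, HasDerivAt (fun y => u y * w y) (w y ^ 2 + (y ^ 2 - c) * u y ^ 2) y := by
    intro y
    refine ((hu y).mul (hw y)).congr_deriv ?_
    ring
  have hmono : MonotoneOn (fun y => u y * w y) (Set.Ici √c) := by
    refine monotoneOn_of_hasDerivWithinAt_nonneg (convex_Ici _)
      (fun y _ => (hg y).continuousAt.continuousWithinAt)
      (fun y _ => (hg y).hasDerivWithinAt) ?_
    intro y hy
    rw [interior_Ici] at hy
    have hy' : c ≤ y ^ 2 := Real.sqrt_le_iff.1 (le_of_lt hy) |>.2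
    have : 0 ≤ (y ^ 2 - c) * u y ^ 2 := mul_nonneg (by linarith) (sq_nonneg _)
    positivity
  have hneg : ∀ y, √c ≤ y → u y * w y ≤ 0 := fun y hy =>
    ge_of_tendsto hlim ((eventually_ge_atTop y).mono fun z hz =>
      hmono (Set.mem_Ici.2 hy) (Set.mem_Ici.2 (hy.trans hz)) hz)
  have hanti : AntitoneOn (fun y => u y ^ 2) (Set.Ici √c) := by
    refine antitoneOn_of_hasDerivWithinAt_nonpos (convex_Ici _)
      (fun y _ => ((hu y).pow 2).continuousAt.continuousWithinAt)
      (fun y _ => ((hu y).pow 2).hasDerivWithinAt) ?_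
    intro y hy
    rw [interior_Ici] at hy
    have := hneg y (le_of_lt hy)
    push_cast
    linarith
  exact hanti (Set.mem_Ici.2 le_rfl) (Set.mem_Ici.2 hx) hx

/-- A solution of `u'' = (x² - c) u`, `c ≥ 1`, with `u u' → 0` is bounded on `[0, ∞)` by twice the
square root of its initial energy. -/
theorem oscillator_abs_le (hc : 1 ≤ c) (hu : ∀ x, HasDerivAt u (w x) x)
    (hw : ∀ x, HasDerivAt w ((x ^ 2 - c) * u x) x)
    (hlim : Tendsto (fun x => u x * w x) atTop (𝓝 0)) {x : ℝ} (hx : 0 ≤ x) :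
    |u x| ≤ 2 * √(w 0 ^ 2 + c * u 0 ^ 2) := by
  set A := w 0 ^ 2 + c * u 0 ^ 2
  have hE := fun {y : ℝ} (hy : 0 ≤ y) => oscillator_energy_le hu hw hy
  have hm := Real.sq_sqrt (sub_nonneg.2 hc)
  have hX := Real.sq_sqrt (zero_le_one.trans hc)
  have hm0 := Real.sqrt_nonneg (c - 1)
  have hX0 := Real.sqrt_nonneg c
  have hlow : ∀ y, 0 ≤ y → y ≤ √(c - 1) → |u y| ≤ √A := by
    intro y hy hym
    refine Real.abs_le_sqrt ?_
    have h1 : y ^ 2 ≤ c - 1 := hm ▸ pow_le_pow_left₀ hy hym 2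
    have := hE hy
    nlinarith [sq_nonneg (w y), mul_nonneg (sub_nonneg.2 h1) (sq_nonneg (u y))]
  have hmid : ∀ y, √(c - 1) ≤ y → y ≤ √c → |u y| ≤ 2 * √A := by
    intro y hmy hyX
    have hw' : ∀ z ∈ Set.Icc √(c - 1) √c, ‖w z‖ ≤ √A := by
      intro z hz
      have hz0 : 0 ≤ z := hm0.trans hz.1
      refine Real.abs_le_sqrt ?_
      have h1 : z ^ 2 ≤ c := hX ▸ pow_le_pow_left₀ hz0 hz.2 2
      have := hE hz0
      nlinarith [mul_nonneg (sub_nonneg.2 h1) (sq_nonneg (u z))]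
    have hd := (convex_Icc √(c - 1) √c).norm_image_sub_le_of_norm_hasDerivWithin_le
      (fun z _ => (hu z).hasDerivWithinAt) hw'
      ⟨le_rfl, hmy.trans hyX⟩ ⟨hmy, hyX⟩
    have hlen : y - √(c - 1) ≤ 1 := by nlinarith
    rw [Real.norm_eq_abs, Real.norm_eq_abs, abs_of_nonneg (sub_nonneg.2 hmy)] at hd
    have h2 := mul_le_mul_of_nonneg_left hlen (Real.sqrt_nonneg A)
    have h3 := hlow _ hm0 le_rfl
    have h4 := abs_sub_abs_le_abs_sub (u y) (u √(c - 1))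
    linarith
  have hmX : √(c - 1) ≤ √c := Real.sqrt_le_sqrt (by linarith)
  rcases le_total x √(c - 1) with h | h
  · linarith [hlow x hx h, Real.sqrt_nonneg A]
  rcases le_total x √c with h' | h'
  · exact hmid x h h'
  · exact (sq_le_sq.1 (oscillator_sq_le_turning_point hu hw hlim h')).trans (hmid _ hmX le_rfl)

end Oscillator

theorem hasDerivAt_Hpoly (n : ℕ) (x : ℝ) :
    HasDerivAt (Hpoly n) (2 * x * Hpoly n x - Hpoly (n + 1) x) x ∧
      HasDerivAt (Hpoly (n + 1)) (2 * (n + 1) * Hpoly n x) x := by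
  induction n with
  | zero =>
    constructor
    · simpa [Hpoly] using hasDerivAt_const x (1 : ℝ)
    · simpa [Hpoly] using (hasDerivAt_id x).const_mul 2
  | succ n ih =>
    refine ⟨ih.2.congr_deriv (by simp only [Hpoly]; ring), ?_⟩
    have h := (((hasDerivAt_id x).const_mul 2).mul ih.2).sub (ih.1.const_mul (2 * ((n : ℝ) + 1)))
    refine h.congr_deriv ?_
    simp only [id]
    push_cast
    ring

theorem abs_Hpoly_neg (n : ℕ) (x : ℝ) : |Hpoly n (-x)| = |Hpoly n x| := by
  have h : ∀ n, Hpoly n (-x) = (-1) ^ n * Hpoly n x ∧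
      Hpoly (n + 1) (-x) = (-1) ^ (n + 1) * Hpoly (n + 1) x := by
    intro n
    induction n with
    | zero => simp [Hpoly]
    | succ n ih =>
      refine ⟨ih.2, ?_⟩
      simp only [Hpoly, ih.1, ih.2]
      ring
  rw [(h n).1, abs_mul, abs_pow, abs_neg, abs_one, one_pow, one_mul]

theorem Hpoly_zero_sq_le (n : ℕ) : Hpoly n 0 ^ 2 ≤ 2 ^ n * n.factorial := by
  have h : ∀ n, Hpoly n 0 ^ 2 ≤ 2 ^ n * n.factorial ∧
      Hpoly (n + 1) 0 ^ 2 ≤ 2 ^ (n + 1) * (n + 1).factorial := by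
    intro n
    induction n with
    | zero => simp [Hpoly]
    | succ n ih =>
      refine ⟨ih.2, ?_⟩
      have h1 : Hpoly (n + 1 + 1) 0 ^ 2 = 4 * (n + 1) ^ 2 * Hpoly n 0 ^ 2 := by
        simp only [Hpoly]
        ring
      have h2 : (2 : ℝ) ^ (n + 1 + 1) * ((n + 1 + 1).factorial : ℝ) =
          4 * ((n + 1) * (n + 2)) * (2 ^ n * n.factorial) := by
        rw [Nat.factorial_succ, Nat.factorial_succ]
        push_cast
        ring
      rw [h1, h2]
      have h3 : (4 : ℝ) * (n + 1) ^ 2 ≤ 4 * ((n + 1) * (n + 2)) := by nlinarith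
      exact mul_le_mul h3 ih.1 (sq_nonneg _) (by positivity)
  exact (h n).1

theorem tendsto_pow_mul_Hpoly_mul_exp (n k : ℕ) :
    Tendsto (fun x => x ^ k * Hpoly n x * exp (-(x ^ 2 / 2))) atTop (𝓝 0) := by
  have h : ∀ n, (∀ k, Tendsto (fun x => x ^ k * Hpoly n x * exp (-(x ^ 2 / 2))) atTop (𝓝 0)) ∧
      ∀ k, Tendsto (fun x => x ^ k * Hpoly (n + 1) x * exp (-(x ^ 2 / 2))) atTop (𝓝 0) := by
    have h0 : ∀ k : ℕ,
        Tendsto (fun x : ℝ => x ^ k * exp (-(x ^ 2 / 2))) atTop (𝓝 0) := by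
      intro k
      refine squeeze_zero' ?_ ?_ (Real.tendsto_pow_mul_exp_neg_atTop_nhds_zero k)
      · filter_upwards [eventually_ge_atTop 0] with x hx
        positivity
      · filter_upwards [eventually_ge_atTop 2] with x hx
        have : -(x ^ 2 / 2) ≤ -x := by nlinarith
        gcongr
    intro n
    induction n with
    | zero =>
      refine ⟨fun k => by simpa [Hpoly] using h0 k, fun k => ?_⟩
      have := (h0 (k + 1)).const_mul 2
      rw [mul_zero] at this
      refine this.congr fun x => ?_
      simp only [Hpoly]
      ring
    | succ n ih =>
      refine ⟨ih.2, fun k => ?_⟩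
      have := ((ih.2 (k + 1)).const_mul 2).sub ((ih.1 k).const_mul (2 * ((n : ℝ) + 1)))
      rw [mul_zero, mul_zero, sub_zero] at this
      refine this.congr fun x => ?_
      simp only [Hpoly]
      ring
  exact (h n).1 k

theorem abs_Hpoly_mul_exp_le (n : ℕ) (x : ℝ) :
    |Hpoly (n + 1) x| * exp (-(x ^ 2 / 2)) ≤
      2 * √((4 * (n + 1) + 1) * (2 ^ (n + 1) * (n + 1).factorial)) := by
  have hexp : ∀ y : ℝ, HasDerivAt (fun y : ℝ => exp (-(y ^ 2 / 2)))
      (-y * exp (-(y ^ 2 / 2))) y := by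
    intro y
    refine (((hasDerivAt_id y).pow 2).div_const 2).neg.exp.congr_deriv ?_
    simp only [id, Pi.neg_apply, Pi.pow_apply]
    push_cast
    ring
  let u : ℝ → ℝ := fun y => Hpoly (n + 1) y * exp (-(y ^ 2 / 2))
  let w : ℝ → ℝ := fun y => (2 * (n + 1) * Hpoly n y - y * Hpoly (n + 1) y) * exp (-(y ^ 2 / 2))
  have hu : ∀ y, HasDerivAt u (w y) y := by
    intro y
    refine ((hasDerivAt_Hpoly n y).2.mul (hexp y)).congr_deriv ?_
    simp only [w]
    ring
  have hw : ∀ y, HasDerivAt w ((y ^ 2 - (2 * (n + 1) + 1)) * u y) y := by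
    intro y
    have h := ((((hasDerivAt_Hpoly n y).1.const_mul (2 * ((n : ℝ) + 1))).sub
      ((hasDerivAt_id y).mul (hasDerivAt_Hpoly n y).2)).mul (hexp y))
    refine h.congr_deriv ?_
    simp only [u, id, Pi.sub_apply, Pi.mul_apply]
    ring
  have hlim : Tendsto (fun y => u y * w y) atTop (𝓝 0) := by
    have h := (tendsto_pow_mul_Hpoly_mul_exp (n + 1) 0).mul
      (((tendsto_pow_mul_Hpoly_mul_exp n 0).const_mul (2 * ((n : ℝ) + 1))).sub
        (tendsto_pow_mul_Hpoly_mul_exp (n + 1) 1))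
    rw [zero_mul] at h
    refine h.congr fun y => ?_
    simp only [u, w]
    ring
  have hmain := oscillator_abs_le (by linarith [n.cast_nonneg (α := ℝ)]) hu hw hlim (abs_nonneg x)
  have hux : |u (|x|)| = |Hpoly (n + 1) x| * exp (-(x ^ 2 / 2)) := by
    simp only [u, abs_mul, sq_abs, Real.abs_exp]
    rcases abs_choice x with h | h <;> rw [h]
    rw [abs_Hpoly_neg]
  rw [← hux]
  refine hmain.trans (mul_le_mul_of_nonneg_left (Real.sqrt_le_sqrt ?_) zero_le_two)
  have hu0 : u 0 = Hpoly (n + 1) 0 := by simp [u]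
  have hw0 : w 0 = 2 * (n + 1) * Hpoly n 0 := by simp [w]
  have hfac : (2 : ℝ) ^ (n + 1) * ((n + 1).factorial : ℝ) =
      2 * (n + 1) * (2 ^ n * n.factorial) := by
    rw [Nat.factorial_succ]
    push_cast
    ring
  have h1 := mul_le_mul_of_nonneg_left (Hpoly_zero_sq_le n)
    (by positivity : (0 : ℝ) ≤ (2 * (n + 1)) ^ 2)
  have h2 := mul_le_mul_of_nonneg_left (Hpoly_zero_sq_le (n + 1))
    (by positivity : (0 : ℝ) ≤ 2 * (n + 1) + 1)
  rw [hu0, hw0, mul_pow]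
  calc (2 * ((n : ℝ) + 1)) ^ 2 * Hpoly n 0 ^ 2 + (2 * (n + 1) + 1) * Hpoly (n + 1) 0 ^ 2
      ≤ _ := add_le_add h1 h2
    _ = _ := by rw [hfac]; ring

/-- For every `n ≥ 6` and every `t ∈ ℝ`, `|φ_n(t)| < 30 √n exp(t²/2)`. -/
theorem phi_bound (n : ℕ) (hn : 6 ≤ n) (t : ℝ) :
    |phi n t| < 30 * Real.sqrt n * Real.exp (t ^ 2 / 2) := by
  obtain ⟨k, rfl⟩ : ∃ k, n = k + 1 := ⟨n - 1, by omega⟩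
  set N : ℝ := 2 ^ (k + 1) * (k + 1).factorial with hN
  have hN0 : 0 < N := by positivity
  set x : ℝ := (5 : ℝ) ^ ((1 : ℝ) / 4) * t with hx
  have hx2 : x ^ 2 = √5 * t ^ 2 := by
    rw [hx, mul_pow, ← Real.rpow_natCast, ← Real.rpow_mul (by norm_num), Real.sqrt_eq_rpow]
    norm_num
  have hexp : exp (-((√5 - 1) / 2) * t ^ 2) = exp (-(x ^ 2 / 2)) * exp (t ^ 2 / 2) := by
    rw [← Real.exp_add, hx2]
    ring_nf
  have hb : (5 : ℝ) ^ ((1 : ℝ) / 8) ≤ 5 := by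
    simpa using Real.rpow_le_rpow_of_exponent_le (by norm_num : (1 : ℝ) ≤ 5)
      (by norm_num : (1 : ℝ) / 8 ≤ 1)
  have hsq : √((4 * (k + 1) + 1) * N) ≤ 5 / 2 * √((k + 1 : ℕ) : ℝ) * √N := by
    rw [Real.sqrt_mul (by positivity)]
    refine mul_le_mul_of_nonneg_right ?_ (Real.sqrt_nonneg _)
    rw [Real.sqrt_le_left (by positivity), mul_pow, Real.sq_sqrt (by positivity)]
    push_cast
    linarith [k.cast_nonneg (α := ℝ)]
  have hH := (abs_Hpoly_mul_exp_le k x).trans (mul_le_mul_of_nonneg_left hsq zero_le_two)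
  have hsN : 0 < √N := Real.sqrt_pos.2 hN0
  have hs : 0 < √((k + 1 : ℕ) : ℝ) := Real.sqrt_pos.2 (by positivity)
  have hphi : |phi (k + 1) t| = (5 : ℝ) ^ ((1 : ℝ) / 8) *
      (|Hpoly (k + 1) x| * exp (-(x ^ 2 / 2)) / √N) * exp (t ^ 2 / 2) := by
    rw [phi, ← hN, ← hx, hexp, abs_mul, abs_of_pos (by positivity)]
    ring
  rw [hphi]
  refine mul_lt_mul_of_pos_right ?_ (exp_pos _)
  have hq : |Hpoly (k + 1) x| * exp (-(x ^ 2 / 2)) / √N ≤ 5 * √((k + 1 : ℕ) : ℝ) := by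
    rw [div_le_iff₀ hsN]
    linarith
  calc _ ≤ 5 * (5 * √((k + 1 : ℕ) : ℝ)) := mul_le_mul hb hq (by positivity) (by norm_num)
    _ < _ := by linarith
end

section
/- For every even integer n > 1, one has n! / (n/2)! < 1.5 · (2n/e)^{n/2}. -/
theorem factorial_eq_stirlingSeq_mul {n : ℕ} (hn : n ≠ 0) :
    (n.factorial : ℝ) = Stirling.stirlingSeq n * (√(2 * n) * (n / Real.exp 1) ^ n) := by
  have : (0 : ℝ) < n := by positivity
  rw [Stirling.stirlingSeq, div_mul_cancel₀]
  positivity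

theorem factorial_two_mul_le {m : ℕ} (hm : m ≠ 0) :
    ((2 * m).factorial : ℝ) ≤ √2 * (4 * m / Real.exp 1) ^ m * m.factorial := by
  have hanti : Stirling.stirlingSeq (2 * m) ≤ Stirling.stirlingSeq m := by
    have h := Stirling.stirlingSeq'_antitone (show m - 1 ≤ 2 * m - 1 by lia)
    simpa [Nat.succ_eq_add_one, Nat.sub_add_cancel (show 1 ≤ m by lia),
      Nat.sub_add_cancel (show 1 ≤ 2 * m by lia)] using h
  have hsqrt : √(2 * (2 * m : ℕ) : ℝ) = √2 * √(2 * m) := by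
    rw [← Real.sqrt_mul (by norm_num)]
    push_cast
    rfl
  have hpow : ((2 * m : ℕ) / Real.exp 1) ^ (2 * m)
      = (4 * m / Real.exp 1) ^ m * (m / Real.exp 1) ^ m := by
    rw [pow_mul, ← mul_pow]
    push_cast
    ring
  rw [factorial_eq_stirlingSeq_mul (show 2 * m ≠ 0 by lia), factorial_eq_stirlingSeq_mul hm,
    hsqrt, hpow]
  calc _ ≤ Stirling.stirlingSeq m * (√2 * √(2 * m) *
        ((4 * m / Real.exp 1) ^ m * (m / Real.exp 1) ^ m)) := by gcongr
    _ = _ := by ring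

/-- For every even integer `n > 1`, `n!/(n/2)! < 1.5 (2n/e)^(n/2)`. -/
theorem factorial_ratio_bound (n : ℕ) (hn : 1 < n) (heven : Even n) :
    (n.factorial : ℝ) / ((n / 2).factorial : ℝ)
      < 1.5 * (2 * n / Real.exp 1) ^ ((n : ℝ) / 2) := by
  obtain ⟨m, rfl⟩ := heven.two_dvd
  have hm : m ≠ 0 := by lia
  have hm' : (0 : ℝ) < m := by positivity
  have hexp : ((2 * m : ℕ) : ℝ) / 2 = m := by
    push_cast
    ring
  have hbase : (2 * (2 * m : ℕ) : ℝ) = 4 * m := by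
    push_cast
    ring
  have hsqrt : √2 < 1.5 := by
    rw [Real.sqrt_lt' (by norm_num)]
    norm_num
  rw [hexp, hbase, Real.rpow_natCast, Nat.mul_div_cancel_left m two_pos]
  calc _ ≤ √2 * (4 * m / Real.exp 1) ^ m :=
        (div_le_iff₀ (by positivity)).2 (factorial_two_mul_le hm)
    _ < _ := by gcongr
end

section
/- For every integer N > 6, the sum ∑ (mnp)^{0.7} / 2^{m+n+p}, taken over all triples (m,n,p) of positive integers with max(m,n,p) > N, is strictly less than 24 · N^{0.7} / 2^N. -/
theorem HasSum.mul_mul_of_nonneg {a b c : ℕ → ℝ} {A B C : ℝ} (ha : HasSum a A) (hb : HasSum b B)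
    (hc : HasSum c C) (ha0 : 0 ≤ a) (hb0 : 0 ≤ b) (hc0 : 0 ≤ c) :
    HasSum (fun q : ℕ × ℕ × ℕ => a q.1 * b q.2.1 * c q.2.2) (A * B * C) := by
  have hbc : Summable fun q : ℕ × ℕ => b q.1 * c q.2 :=
    hb.summable.mul_of_nonneg hc.summable hb0 hc0
  have habc := ha.mul (hb.mul hc hbc) (ha.summable.mul_of_nonneg hbc ha0
    fun q => mul_nonneg (hb0 q.1) (hc0 q.2))
  simpa only [mul_assoc] using habc

theorem hasSum_natCast_div_two_pow : HasSum (fun k : ℕ => (k : ℝ) / 2 ^ k) 2 := by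
  have h := hasSum_coe_mul_geometric_of_norm_lt_one (𝕜 := ℝ) (r := 1 / 2) (by norm_num)
  norm_num at h
  simpa only [div_eq_mul_inv, one_mul, inv_pow] using h

theorem hasSum_natCast_div_two_pow_tail (N : ℕ) :
    HasSum (fun k : ℕ => if N < k then (k : ℝ) / 2 ^ k else 0) ((N + 2) / 2 ^ N) := by
  rw [← hasSum_nat_add_iff' (N + 1), Finset.sum_eq_zero, sub_zero]
  · have h := (hasSum_natCast_div_two_pow.add
      (hasSum_geometric_two.mul_left (N + 1 : ℝ))).div_const (2 ^ (N + 1))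
    have hval : (2 + (N + 1 : ℝ) * 2) / 2 ^ (N + 1) = (N + 2) / 2 ^ N := by
      field_simp
      ring
    rw [hval] at h
    refine Eq.mpr (congrArg (HasSum · _) (funext fun i => ?_)) h
    rw [if_pos (by lia), one_div, inv_pow]
    push_cast
    field_simp
    ring
  · intro k hk
    rw [if_neg (by simpa [Nat.lt_succ_iff] using hk)]

theorem natCast_rpow_le_self (k : ℕ) : (k : ℝ) ^ ((7 : ℝ) / 10) ≤ k := by
  rcases k.eq_zero_or_pos with rfl | hk
  · rw [Nat.cast_zero, Real.zero_rpow (by norm_num)]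
  · exact Real.rpow_le_self_of_one_le (by exact_mod_cast hk) (by norm_num)

theorem natCast_rpow_le_rpow_div_mul {N k : ℕ} (hN : 0 < N) (hk : N ≤ k) :
    (k : ℝ) ^ ((7 : ℝ) / 10) ≤ (N : ℝ) ^ ((7 : ℝ) / 10) / N * k := by
  have hN' : (0 : ℝ) < N := by exact_mod_cast hN
  have h1 : (1 : ℝ) ≤ k / N := (one_le_div hN').2 (by exact_mod_cast hk)
  calc (k : ℝ) ^ ((7 : ℝ) / 10) = (N * (k / N) : ℝ) ^ ((7 : ℝ) / 10) := by
        rw [mul_div_cancel₀ _ hN'.ne']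
    _ = (N : ℝ) ^ ((7 : ℝ) / 10) * (k / N : ℝ) ^ ((7 : ℝ) / 10) :=
        Real.mul_rpow hN'.le (by positivity)
    _ ≤ (N : ℝ) ^ ((7 : ℝ) / 10) * (k / N) := by
        gcongr
        exact Real.rpow_le_self_of_one_le h1 (by norm_num)
    _ = _ := by ring

/-- For every integer `N > 6`, the sum `∑ (mnp)^(0.7)/2^(m+n+p)` over all triples of
positive integers with `max(m,n,p) > N` is strictly less than `24 N^(0.7)/2^N`. -/
theorem tail_sum_max_bound (N : ℕ) (hN : 6 < N) :
    Summable (fun q : {q : ℕ × ℕ × ℕ // 0 < q.1 ∧ 0 < q.2.1 ∧ 0 < q.2.2 ∧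
        N < max q.1 (max q.2.1 q.2.2)} =>
      ((q.1.1 * q.1.2.1 * q.1.2.2 : ℝ) ^ ((7 : ℝ) / 10)) / 2 ^ (q.1.1 + q.1.2.1 + q.1.2.2)) ∧
    (∑' q : {q : ℕ × ℕ × ℕ // 0 < q.1 ∧ 0 < q.2.1 ∧ 0 < q.2.2 ∧
        N < max q.1 (max q.2.1 q.2.2)},
      ((q.1.1 * q.1.2.1 * q.1.2.2 : ℝ) ^ ((7 : ℝ) / 10)) / 2 ^ (q.1.1 + q.1.2.1 + q.1.2.2))
      < 24 * (N : ℝ) ^ ((7 : ℝ) / 10) / 2 ^ N := by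
  have hN' : (6 : ℝ) < N := by exact_mod_cast hN
  set c : ℝ := (N : ℝ) ^ ((7 : ℝ) / 10) / N with hc
  have hc0 : 0 < c := by positivity
  set f : ℕ → ℝ := fun k => (k : ℝ) ^ ((7 : ℝ) / 10) / 2 ^ k with hf
  set a : ℕ → ℝ := fun k => (k : ℝ) / 2 ^ k with ha
  set t : ℕ → ℝ := fun k => c * if N < k then (k : ℝ) / 2 ^ k else 0 with ht
  have hf0 : ∀ k, 0 ≤ f k := fun k => by positivity
  have ha0 : 0 ≤ a := fun k => by simp only [ha, Pi.zero_apply]; positivity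
  have ht0 : 0 ≤ t := fun k => by
    simp only [ht, Pi.zero_apply]
    split_ifs <;> positivity
  have hfa : ∀ k, f k ≤ a k := fun k => by
    simp only [hf, ha]
    gcongr
    exact natCast_rpow_le_self k
  have hft : ∀ k, N < k → f k ≤ t k := fun k hk => by
    simp only [hf, ht, if_pos hk, ← mul_div_assoc]
    gcongr
    exact natCast_rpow_le_rpow_div_mul (by lia) hk.le
  have hA : HasSum a 2 := hasSum_natCast_div_two_pow
  have hT : HasSum t (c * ((N + 2) / 2 ^ N)) := (hasSum_natCast_div_two_pow_tail N).mul_left c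
  have hH := ((hT.mul_mul_of_nonneg hA hA ht0 ha0 ha0).add
    (hA.mul_mul_of_nonneg hT hA ha0 ht0 ha0)).add (hA.mul_mul_of_nonneg hA hT ha0 ha0 ht0)
  set H : ℕ × ℕ × ℕ → ℝ := fun q => t q.1 * a q.2.1 * a q.2.2 + a q.1 * t q.2.1 * a q.2.2
    + a q.1 * a q.2.1 * t q.2.2 with hHdef
  have h3 : ∀ x y z : ℕ, 0 ≤ t x * a y * a z ∧ 0 ≤ a x * t y * a z ∧ 0 ≤ a x * a y * t z :=
    fun x y z => ⟨mul_nonneg (mul_nonneg (ht0 x) (ha0 y)) (ha0 z),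
      mul_nonneg (mul_nonneg (ha0 x) (ht0 y)) (ha0 z),
      mul_nonneg (mul_nonneg (ha0 x) (ha0 y)) (ht0 z)⟩
  have hmul : ∀ {x y z x' y' z' : ℝ}, 0 ≤ x → 0 ≤ y → 0 ≤ z → x ≤ x' → y ≤ y' → z ≤ z' →
      x * y * z ≤ x' * y' * z' := fun hx hy hz hxx hyy hzz =>
    mul_le_mul (mul_le_mul hxx hyy hy (hx.trans hxx)) hzz hz
      (mul_nonneg (hx.trans hxx) (hy.trans hyy))
  have hbound : ∀ m n p : ℕ, N < max m (max n p) →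
      (m * n * p : ℝ) ^ ((7 : ℝ) / 10) / 2 ^ (m + n + p) ≤ H (m, n, p) := by
    intro m n p h
    have hprod : (m * n * p : ℝ) ^ ((7 : ℝ) / 10) / 2 ^ (m + n + p) = f m * f n * f p := by
      rw [Real.mul_rpow (by positivity) (by positivity),
        Real.mul_rpow (by positivity) (by positivity), pow_add, pow_add]
      simp only [hf]
      field_simp
    rw [hprod]
    obtain ⟨h1, h2, h3⟩ := h3 m n p
    simp only [hHdef]
    rcases lt_max_iff.1 h with h | h
    · linarith [hmul (hf0 m) (hf0 n) (hf0 p) (hft m h) (hfa n) (hfa p)]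
    rcases lt_max_iff.1 h with h | h
    · linarith [hmul (hf0 m) (hf0 n) (hf0 p) (hfa m) (hft n h) (hfa p)]
    · linarith [hmul (hf0 m) (hf0 n) (hf0 p) (hfa m) (hfa n) (hft p h)]
  have hH0 : 0 ≤ H := fun q => by
    obtain ⟨h1, h2, h3⟩ := h3 q.1 q.2.1 q.2.2
    exact add_nonneg (add_nonneg h1 h2) h3
  have hHs := hH.summable.subtype {q : ℕ × ℕ × ℕ | 0 < q.1 ∧ 0 < q.2.1 ∧ 0 < q.2.2 ∧
    N < max q.1 (max q.2.1 q.2.2)}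
  have hs := Summable.of_nonneg_of_le
    (f := fun q : {q : ℕ × ℕ × ℕ // 0 < q.1 ∧ 0 < q.2.1 ∧ 0 < q.2.2 ∧
      N < max q.1 (max q.2.1 q.2.2)} => H q.1)
    (fun q => by positivity) (fun q => hbound q.1.1 q.1.2.1 q.1.2.2 q.2.2.2.2) hHs
  refine ⟨hs, ?_⟩
  calc _ ≤ ∑' q : {q : ℕ × ℕ × ℕ // 0 < q.1 ∧ 0 < q.2.1 ∧ 0 < q.2.2 ∧
        N < max q.1 (max q.2.1 q.2.2)}, H q.1 :=
        hs.tsum_le_tsum (fun q => hbound q.1.1 q.1.2.1 q.1.2.2 q.2.2.2.2) hHs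
    _ ≤ ∑' q, H q := hH.summable.tsum_subtype_le H _ hH0
    _ = 12 * c * (N + 2) / 2 ^ N := by rw [hH.tsum_eq]; ring
    _ < 24 * (N : ℝ) ^ ((7 : ℝ) / 10) / 2 ^ N := by
        have hcN : (N : ℝ) ^ ((7 : ℝ) / 10) = c * N := by rw [hc]; field_simp
        rw [hcN]
        gcongr ?_ / _
        nlinarith
end
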